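/- For all integers m, n ≥ 1, the group ℤ/2^mℤ × ℤ/2^nℤ does not have property L_2 (and hence does not have property L). -/

import Mathlib

/-- The natural reduction ring homomorphism `W₂(k) → k` from length-two `p`-typical
Witt vectors to `k`, given by the zeroth coefficient. -/
noncomputable def wittReduce (p : ℕ) [Fact p.Prime] (k : Type*) [CommRing k] :
    TruncatedWittVector p 2 k →+* k :=
  RingHom.liftOfRightInverse (WittVector.truncate 2) TruncatedWittVector.out
    TruncatedWittVector.truncateFun_out
    ⟨WittVector.constantCoeff, fun x hx => by
      rw [WittVector.mem_ker_truncate] at hx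
      simpa [RingHom.mem_ker] using hx 0 (by norm_num)⟩

/-- A finite group `G` has property `L_p` if every homomorphism `G → GL_n(k)`, for `k` a
finite field of characteristic `p`, lifts to `GL_n(W₂(k))`. -/
def HasLp (p : ℕ) [Fact p.Prime] (G : Type*) [Group G] : Prop :=
  ∀ (n : ℕ), 1 ≤ n → ∀ (k : Type) [Field k] [Fintype k] [CharP k p],
    ∀ f : G →* GL (Fin n) k,
      ∃ g : G →* GL (Fin n) (TruncatedWittVector p 2 k),
        (Matrix.GeneralLinearGroup.map (wittReduce p k)).comp g = f

/-- A group has property `L` if it has property `L_p` for every prime `p`. -/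
def HasL (G : Type*) [Group G] : Prop :=
  ∀ (p : ℕ) [Fact p.Prime], HasLp p G

section

open Matrix

theorem wittReduce_truncate (p : ℕ) [Fact p.Prime] (k : Type*) [CommRing k] (x : WittVector p k) :
    wittReduce p k (WittVector.truncate 2 x) = x.coeff 0 :=
  RingHom.liftOfRightInverse_comp_apply _ _ _ _ x

theorem wittReduce_surjective (p : ℕ) [Fact p.Prime] (k : Type*) [CommRing k] :
    Function.Surjective (wittReduce p k) := fun c =>
  ⟨WittVector.truncate 2 (WittVector.teichmuller p c), by
    rw [wittReduce_truncate, WittVector.teichmuller_coeff_zero]⟩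

/-- The kernel of the reduction `W₂(k) → k` has square zero. -/
theorem mul_eq_zero_of_wittReduce_eq_zero {p : ℕ} [Fact p.Prime] {k : Type*} [CommRing k]
    [CharP k p] {x y : TruncatedWittVector p 2 k} (hx : wittReduce p k x = 0)
    (hy : wittReduce p k y = 0) : x * y = 0 := by
  obtain ⟨x, rfl⟩ := WittVector.truncate_surjective p 2 k x
  obtain ⟨y, rfl⟩ := WittVector.truncate_surjective p 2 k y
  rw [wittReduce_truncate] at hx hy
  have hx' : WittVector.verschiebung (x.shift 1) = x :=
    (WittVector.eq_iterate_verschiebung (n := 1) fun i hi => by rwa [Nat.lt_one_iff.1 hi]).symm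
  have hy' : WittVector.verschiebung (y.shift 1) = y :=
    (WittVector.eq_iterate_verschiebung (n := 1) fun i hi => by rwa [Nat.lt_one_iff.1 hi]).symm
  rw [← map_mul, ← RingHom.mem_ker, WittVector.mem_ker_truncate, ← hx', ← hy',
    ← WittVector.verschiebung_mul_frobenius, WittVector.frobenius_verschiebung, ← mul_assoc]
  intro i hi
  interval_cases i
  · simp
  · rw [WittVector.verschiebung_coeff_succ, WittVector.mul_charP_coeff_zero]

/-- The annihilator of `p` in `W₂(k)` is the kernel of the reduction `W₂(k) → k`. -/
theorem mul_natCast_eq_zero_iff_wittReduce_eq_zero {p : ℕ} [Fact p.Prime] {k : Type*} [CommRing k]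
    [IsReduced k] [CharP k p] (x : TruncatedWittVector p 2 k) :
    x * p = 0 ↔ wittReduce p k x = 0 := by
  obtain ⟨x, rfl⟩ := WittVector.truncate_surjective p 2 k x
  rw [wittReduce_truncate, ← map_natCast (WittVector.truncate 2), ← map_mul, ← RingHom.mem_ker,
    WittVector.mem_ker_truncate]
  refine ⟨fun h => ?_, fun h i hi => ?_⟩
  · have := h 1 one_lt_two
    rw [WittVector.mul_charP_coeff_succ] at this
    exact pow_eq_zero_iff (Fact.out : p.Prime).ne_zero |>.1 this
  · interval_cases i
    · rw [WittVector.mul_charP_coeff_zero]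
    · rw [WittVector.mul_charP_coeff_succ, h, zero_pow (Fact.out : p.Prime).ne_zero]

theorem add_pow_two_pow_succ_of_four_eq_zero {R : Type*} [CommRing R] (h4 : (4 : R) = 0)
    (u v : R) (n : ℕ) :
    (u + v) ^ 2 ^ (n + 1) = u ^ 2 ^ (n + 1) + v ^ 2 ^ (n + 1) + 2 * (u * v) ^ 2 ^ n := by
  induction n with
  | zero => ring
  | succ n ih =>
    rw [pow_succ 2 (n + 1), pow_mul, pow_mul u, pow_mul v, ih]
    rw [show 2 * (u * v) ^ 2 ^ (n + 1) = 2 * (u ^ 2 ^ (n + 1) * v ^ 2 ^ (n + 1)) by rw [mul_pow]]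
    linear_combination ((u ^ 2 ^ (n + 1) + v ^ 2 ^ (n + 1)) * (u * v) ^ 2 ^ n
      + ((u * v) ^ 2 ^ n) ^ 2) * h4

theorem smul_one_add_smul_pow_two_pow_succ {R M : Type*} [CommRing R] [Ring M] [Algebra R M]
    (h4 : (4 : R) = 0) (a b : R) (S : M) (n : ℕ) :
    (a • (1 : M) + b • S) ^ 2 ^ (n + 1) = a ^ 2 ^ (n + 1) • (1 : M) +
      b ^ 2 ^ (n + 1) • S ^ 2 ^ (n + 1) + (2 * (a * b) ^ 2 ^ n) • S ^ 2 ^ n := by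
  have h4' : (4 : Polynomial R) = 0 := by
    rw [← map_ofNat Polynomial.C, h4, map_zero]
  have := congrArg (Polynomial.aeval S) (add_pow_two_pow_succ_of_four_eq_zero h4'
    (Polynomial.C a) (Polynomial.C b * Polynomial.X) n)
  simp only [map_add, map_mul, map_pow, Polynomial.aeval_C, Polynomial.aeval_X, mul_pow,
    map_ofNat, ← Algebra.smul_def] at this
  simpa only [Algebra.smul_def, map_mul, map_pow, map_ofNat, mul_one, mul_pow, mul_assoc]
    using this

/-- A commuting pair of matrices `S`, `B` over `W₂(k)`, both killed by `2 ^ (n + 1)`, whose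
reductions satisfy `B = (1 - c) + c S`, forces `c ∈ {0, 1}` as soon as `S ^ 2 ^ n` is not diagonal
over `k`. -/
theorem mul_eq_zero_of_commute_lift {k ι : Type*} [Field k] [CharP k 2] [Fintype ι]
    [DecidableEq ι] {S B : Matrix ι ι (TruncatedWittVector 2 2 k)} (hSB : Commute S B) {n : ℕ}
    (hS : S ^ 2 ^ (n + 1) = 1) (hB : B ^ 2 ^ (n + 1) = 1) (c : k)
    (h : (wittReduce 2 k).mapMatrix B =
      (1 - c) • (1 : Matrix ι ι k) + c • (wittReduce 2 k).mapMatrix S)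
    {i j : ι} (hij : i ≠ j) (hSij : (((wittReduce 2 k).mapMatrix S) ^ 2 ^ n) i j ≠ 0) :
    (1 - c) * c = 0 := by
  have h2 (x : TruncatedWittVector 2 2 k) : x * 2 = 0 ↔ wittReduce 2 k x = 0 :=
    mul_natCast_eq_zero_iff_wittReduce_eq_zero x
  have h4 : (4 : TruncatedWittVector 2 2 k) = 0 := by
    have : (2 : TruncatedWittVector 2 2 k) * 2 = 0 := by
      rw [h2, map_ofNat]; exact CharTwo.two_eq_zero
    rw [← this]; norm_num
  obtain ⟨a, ha⟩ := wittReduce_surjective 2 k (1 - c)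
  obtain ⟨b, hb⟩ := wittReduce_surjective 2 k c
  set X : Matrix ι ι (TruncatedWittVector 2 2 k) := a • 1 + b • S with hX
  obtain ⟨E, hE⟩ : ∃ E, E = B - X := ⟨_, rfl⟩
  have hEij (i j) : wittReduce 2 k (E i j) = 0 := by
    have := congrFun (congrFun h i) j
    simp only [RingHom.mapMatrix_apply, Matrix.map_apply, Matrix.add_apply, Matrix.smul_apply,
      smul_eq_mul] at this
    rw [hE, hX]
    simp only [Matrix.sub_apply, Matrix.add_apply, Matrix.smul_apply, smul_eq_mul, map_sub,
      map_add, map_mul, this, ha, hb]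
    rw [Matrix.one_apply, Matrix.one_apply]
    split_ifs <;> simp
  have hEE : E * E = 0 := by
    refine Matrix.ext fun i j => ?_
    rw [Matrix.mul_apply]
    exact Finset.sum_eq_zero fun l _ => mul_eq_zero_of_wittReduce_eq_zero (hEij i l) (hEij l j)
  have hE2 : E + E = 0 := by
    refine Matrix.ext fun i j => ?_
    rw [Matrix.add_apply, ← mul_two, (h2 _).2 (hEij i j), Matrix.zero_apply]
  have hXE : Commute X E := by
    have hXB : Commute X B :=
      ((Commute.one_left B).smul_left a).add_left (hSB.smul_left b)
    rw [hE]
    exact hXB.sub_right (Commute.refl X)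
  have hBX : B ^ 2 = X ^ 2 := by
    have : B = X + E := by rw [hE]; abel
    rw [this, sq, sq, add_mul, mul_add X X E, mul_add E X E, hEE, ← hXE.eq, add_zero, add_assoc,
      ← mul_add X E E, hE2, mul_zero, add_zero]
  have key : (1 : Matrix ι ι (TruncatedWittVector 2 2 k)) = X ^ 2 ^ (n + 1) := by
    rw [← hB, pow_succ', pow_mul, pow_mul, hBX]
  rw [hX, smul_one_add_smul_pow_two_pow_succ h4, hS] at key
  have key' := congrFun (congrFun key i) j
  simp only [Matrix.add_apply, Matrix.smul_apply, Matrix.one_apply_ne hij, smul_eq_mul] at key'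
  have key2 : ((a * b) ^ 2 ^ n * (S ^ 2 ^ n) i j) * 2 = 0 := by
    rw [key']; ring
  rw [h2, map_mul, map_pow, map_mul, ha, hb] at key2
  have hmap : wittReduce 2 k ((S ^ 2 ^ n) i j) = (((wittReduce 2 k).mapMatrix S) ^ 2 ^ n) i j := by
    rw [← map_pow]; rfl
  rw [hmap] at key2
  exact pow_eq_zero_iff (by positivity) |>.1 ((mul_eq_zero.1 key2).resolve_right hSij)

/-- Commuting elements `a`, `b` with `a ^ M = b ^ N = 1` define a homomorphism
from `ℤ/M × ℤ/N`. -/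
theorem exists_monoidHom_zmod_prod {G : Type*} [Group G] {M N : ℕ} {a b : G} (hab : Commute a b)
    (ha : a ^ M = 1) (hb : b ^ N = 1) :
    ∃ f : Multiplicative (ZMod M) × Multiplicative (ZMod N) →* G,
      f (Multiplicative.ofAdd 1, 1) = a ∧ f (1, Multiplicative.ofAdd 1) = b := by
  have cyc {L : ℕ} {x : G} (hx : x ^ L = 1) : ∃ φ : Multiplicative (ZMod L) →* G,
      ∀ z : ℤ, φ (Multiplicative.ofAdd (z : ZMod L)) = x ^ z := by
    refine ⟨AddMonoidHom.toMultiplicativeLeft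
      (ZMod.lift L ⟨zmultiplesHom (Additive G) (.ofMul x), ?_⟩), ?_⟩
    · simp [← ofMul_pow, hx]
    · intro z
      simp
  obtain ⟨φ, hφ⟩ := cyc ha
  obtain ⟨ψ, hψ⟩ := cyc hb
  refine ⟨φ.noncommCoprod ψ fun u v => ?_, ?_, ?_⟩
  · obtain ⟨u, rfl⟩ :=
      ZMod.intCast_surjective u.toAdd |>.imp fun _ h => congrArg Multiplicative.ofAdd h
    obtain ⟨v, rfl⟩ :=
      ZMod.intCast_surjective v.toAdd |>.imp fun _ h => congrArg Multiplicative.ofAdd h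
    rw [hφ, hψ]
    exact hab.zpow_zpow u v
  · simpa using hφ 1
  · simpa using hψ 1

open scoped Fin.CommRing in
/-- For all `m`, there is a matrix of size `2 ^ (m + 1)` and order dividing
`2 ^ (m + 1)` whose `2 ^ m`-th power is not diagonal. -/
theorem exists_matrix_pow_two_pow_eq_one (k : Type*) [Field k] (m : ℕ) :
    ∃ A : Matrix (Fin (2 ^ (m + 1))) (Fin (2 ^ (m + 1))) k, A ^ 2 ^ (m + 1) = 1 ∧
      ∃ i j, i ≠ j ∧ (A ^ 2 ^ m) i j ≠ 0 := by
  have hpow (l : ℕ) : (permMatrixHom (R := k) (Equiv.addRight (1 : Fin (2 ^ (m + 1))))) ^ l =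
      permMatrixHom (Equiv.addRight (l : Fin (2 ^ (m + 1)))) := by
    rw [← map_pow]
    congr 1
    ext1 x
    rw [← Equiv.Perm.iterate_eq_pow, Equiv.coe_addRight, add_right_iterate, nsmul_one]
    rfl
  refine ⟨permMatrixHom (Equiv.addRight 1), ?_, ((2 ^ m : ℕ) : Fin (2 ^ (m + 1))), 0, ?_, ?_⟩
  · rw [hpow]
    simp
  · rw [Ne, Fin.natCast_eq_zero]
    exact Nat.not_dvd_of_pos_of_lt (by positivity) (Nat.pow_lt_pow_right one_lt_two (by omega))
  · rw [hpow, permMatrixHom_apply, Equiv.Perm.permMatrix, PEquiv.toMatrix_apply]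
    simp [Equiv.toPEquiv_apply]

theorem smul_one_add_smul_pow_two_pow_eq_one {k M : Type*} [Field k] [CharP k 2] [Ring M]
    [Algebra k M] (c : k) {S : M} {n : ℕ} (hS : S ^ 2 ^ n = 1) :
    ((1 - c) • (1 : M) + c • S) ^ 2 ^ n = 1 := by
  nontriviality M
  have : CharP M 2 := charP_of_injective_algebraMap (algebraMap k M).injective 2
  rw [add_pow_expChar_pow_of_commute 2 _ (((Commute.one_left S).smul_left _).smul_right _),
    smul_pow, smul_pow, one_pow, hS, ← add_smul, sub_pow_expChar_pow]
  simp

/-- If `ℤ/M × ℤ/N` has property `L_p`, then commuting matrices over `k` killed by `M` and `N`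
lift to commuting matrices over `W₂(k)` killed by `M` and `N`. -/
theorem HasLp.exists_commute_lift {p : ℕ} [Fact p.Prime] {M N : ℕ} (hM : M ≠ 0) (hN : N ≠ 0)
    (H : HasLp p (Multiplicative (ZMod M) × Multiplicative (ZMod N))) {k : Type} [Field k]
    [Fintype k] [CharP k p] {d : ℕ} (hd : 1 ≤ d) {A B : Matrix (Fin d) (Fin d) k}
    (hAB : Commute A B) (hA : A ^ M = 1) (hB : B ^ N = 1) :
    ∃ α β : Matrix (Fin d) (Fin d) (TruncatedWittVector p 2 k), Commute α β ∧
      α ^ M = 1 ∧ β ^ N = 1 ∧ (wittReduce p k).mapMatrix α = A ∧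
      (wittReduce p k).mapMatrix β = B := by
  obtain ⟨f, hfA, hfB⟩ := exists_monoidHom_zmod_prod
    (a := (Units.ofPowEqOne A _ hA hM : GL (Fin d) k)) (b := Units.ofPowEqOne B _ hB hN)
    (Units.ext hAB) (Units.pow_ofPowEqOne _ _) (Units.pow_ofPowEqOne _ _)
  obtain ⟨g, hg⟩ := H d hd k f
  have hred (x : Multiplicative (ZMod M) × Multiplicative (ZMod N)) :
      (wittReduce p k).mapMatrix (g x).val = (f x).val := by
    rw [← hg]; rfl
  refine ⟨(g (Multiplicative.ofAdd 1, 1)).val, (g (1, Multiplicative.ofAdd 1)).val,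
    ((Commute.all _ _).map g).units_val, ?_, ?_, ?_, ?_⟩
  · rw [← Units.val_pow_eq_pow_val, ← map_pow, Prod.pow_mk, one_pow, ← ofAdd_nsmul]
    simp [← Prod.one_eq_mk]
  · rw [← Units.val_pow_eq_pow_val, ← map_pow, Prod.pow_mk, one_pow, ← ofAdd_nsmul]
    simp [← Prod.one_eq_mk]
  · rw [hred, hfA]; rfl
  · rw [hred, hfB]; rfl

theorem HasLp.mul_eq_zero_of_le {m n : ℕ} (hnm : n ≤ m)
    (H : HasLp 2 (Multiplicative (ZMod (2 ^ (m + 1))) × Multiplicative (ZMod (2 ^ (n + 1)))))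
    (k : Type) [Field k] [Fintype k] [CharP k 2] (c : k) : (1 - c) * c = 0 := by
  obtain ⟨A, hA, i, j, hij, hAij⟩ := exists_matrix_pow_two_pow_eq_one k m
  have hd : 1 ≤ 2 ^ (m + 1) := Nat.one_le_two_pow
  have hM : 2 ^ (m + 1) ≠ 0 := by positivity
  have hN : 2 ^ (n + 1) ≠ 0 := by positivity
  have hpow (l : ℕ) : 2 ^ (m - n) * 2 ^ (n + l) = 2 ^ (m + l) := by
    rw [← pow_add]; congr 1; omega
  have hS : (A ^ 2 ^ (m - n)) ^ 2 ^ (n + 1) = 1 := by rw [← pow_mul, hpow, hA]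
  have hSij : ((A ^ 2 ^ (m - n)) ^ 2 ^ n) i j ≠ 0 := by 
    rwa [← pow_mul, show 2 ^ (m - n) * 2 ^ n = 2 ^ m from hpow 0]
  have hAS : Commute A (A ^ 2 ^ (m - n)) := (Commute.refl A).pow_right _
  have hB : ((1 - c) • 1 + c • A ^ 2 ^ (m - n)) ^ 2 ^ (n + 1) = 1 :=
    smul_one_add_smul_pow_two_pow_eq_one c hS
  obtain ⟨α, β, hαβ, hα, hβ, hαA, hβB⟩ := H.exists_commute_lift hM hN hd
    (((Commute.one_right A).smul_right (1 - c)).add_right (hAS.smul_right c)) hA hB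
  exact mul_eq_zero_of_commute_lift (hαβ.pow_left (2 ^ (m - n))) (by rw [← pow_mul, hpow, hα]) hβ c
    (by rw [map_pow, hαA, hβB]) hij (by rwa [map_pow, hαA])

theorem not_hasLp_two_of_le {m n : ℕ} (hnm : n ≤ m) :
    ¬ HasLp 2 (Multiplicative (ZMod (2 ^ (m + 1))) × Multiplicative (ZMod (2 ^ (n + 1)))) := by
  intro H
  let k := GaloisField 2 2
  let _ : Fintype k := Fintype.ofFinite k
  have hcard : Fintype.card k = 4 := by
    rw [← Nat.card_eq_fintype_card, GaloisField.card 2 2 two_ne_zero]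
    norm_num
  classical
  obtain ⟨c, hc⟩ : ∃ c : k, c ∉ ({0, 1} : Finset k) := by
    by_contra! hall
    have := (Finset.card_le_card fun x _ => hall x : (Finset.univ : Finset k).card ≤ _).trans
      Finset.card_le_two
    rw [Finset.card_univ] at this
    omega
  rcases mul_eq_zero.1 (H.mul_eq_zero_of_le hnm k c) with h | h
  · exact hc (by simp [(sub_eq_zero.1 h).symm])
  · exact hc (by simp [h])

theorem HasLp.of_mulEquiv {p : ℕ} [Fact p.Prime] {G H : Type*} [Group G] [Group H] (e : G ≃* H)
    (hG : HasLp p G) : HasLp p H := by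
  intro n hn k _ _ _ f
  obtain ⟨g, hg⟩ := hG n hn k (f.comp e.toMonoidHom)
  refine ⟨g.comp e.symm.toMonoidHom, ?_⟩
  rw [← MonoidHom.comp_assoc, hg]
  ext x : 1
  simp

end

/-- for `m, n ≥ 1`, the group `ℤ/2^mℤ × ℤ/2^nℤ` does not have property `L_2`,
and hence does not have property `L`. -/
theorem zmod_two_pow_times_zmod_two_pow_not_liftable (m n : ℕ) (hm : 1 ≤ m) (hn : 1 ≤ n) :
    ¬ HasLp 2 (Multiplicative (ZMod (2 ^ m)) × Multiplicative (ZMod (2 ^ n))) ∧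
    ¬ HasL (Multiplicative (ZMod (2 ^ m)) × Multiplicative (ZMod (2 ^ n))) := by
  have h : ¬ HasLp 2 (Multiplicative (ZMod (2 ^ m)) × Multiplicative (ZMod (2 ^ n))) := by
    obtain ⟨m, rfl⟩ := Nat.exists_eq_add_of_le' hm
    obtain ⟨n, rfl⟩ := Nat.exists_eq_add_of_le' hn
    rcases le_total n m with hnm | hmn
    · exact not_hasLp_two_of_le hnm
    · exact fun H => not_hasLp_two_of_le hmn (H.of_mulEquiv MulEquiv.prodComm)
  exact ⟨h, fun H => h (H 2)⟩
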